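/- Let K, N, G be positive natural numbers and let A be the integer matrix with rows indexed by (Fin N × Fin G) ⊕ Fin K and columns indexed by Fin K × Fin N × Fin G defined by A((n,s), (k′,n′,s′)) = 1 if n′ = n and s′ = s and 0 otherwise, and A(k, (k′,n′,s′)) = 1 if k′ = k and 0 otherwise. Let b be an integer-valued vector indexed by the rows and let α be a real-valued cost vector indexed by the columns. Consider the polytope P of real vectors x indexed by the columns satisfying A·x = b (over the reals) and 0 ≤ x(col) ≤ 1 for every column. If P is nonempty, then there exists x* ∈ P with every coordinate equal to 0 or 1 such that Σ_col α(col)·x*(col) ≤ Σ_col α(col)·x(col) for every x ∈ P. -/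

import Mathlib

open Finset in
/-- If every edge of a nonempty edge set `F` of a bipartite graph shares each of its endpoints with
another edge of `F`, then there is a nonzero weighting supported on `F` whose weights sum to zero
at every vertex. -/
theorem exists_ne_zero_support_subset_sum_eq_zero {I J : Type*} [Fintype I] [Fintype J]
    [DecidableEq I] [DecidableEq J] (F : Finset (I × J)) (hF : F.Nonempty)
    (hrow : ∀ p ∈ F, ∃ j, j ≠ p.2 ∧ (p.1, j) ∈ F)
    (hcol : ∀ p ∈ F, ∃ i, i ≠ p.1 ∧ (i, p.2) ∈ F) :
    ∃ d : I × J → ℝ, d ≠ 0 ∧ (∀ p ∉ F, d p = 0) ∧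
      (∀ i, ∑ j, d (i, j) = 0) ∧ ∀ j, ∑ i, d (i, j) = 0 := by
  obtain ⟨p₀, hp₀⟩ := hF
  have card_fst : 2 * #(F.image Prod.fst) ≤ #F := by
    refine mul_card_image_le_card (f := Prod.fst) F 2 fun i hi => ?_
    obtain ⟨p, hp, rfl⟩ := mem_image.1 hi
    obtain ⟨j, hj, hjF⟩ := hrow p hp
    exact one_lt_card.2 ⟨p, by simp [hp], (p.1, j), by simp [hjF], fun h => hj (by rw [h])⟩
  have card_snd : 2 * #(F.image Prod.snd) ≤ #F := by
    refine mul_card_image_le_card (f := Prod.snd) F 2 fun j hj => ?_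
    obtain ⟨p, hp, rfl⟩ := mem_image.1 hj
    obtain ⟨i, hi, hiF⟩ := hcol p hp
    exact one_lt_card.2 ⟨p, by simp [hp], (i, p.2), by simp [hiF], fun h => hi (by rw [h])⟩
  have hmem : p₀.1 ∈ F.image Prod.fst := mem_image_of_mem _ hp₀
  let ext : (F → ℝ) →ₗ[ℝ] (I × J → ℝ) := Function.ExtendByZero.linearMap ℝ Subtype.val
  let R : (I × J → ℝ) →ₗ[ℝ] ((F.image Prod.fst).erase p₀.1 → ℝ) :=
    { toFun := fun d i => ∑ j, d (i, j)
      map_add' := fun d e => by ext; simp [sum_add_distrib]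
      map_smul' := fun c d => by ext; simp [mul_sum] }
  let C : (I × J → ℝ) →ₗ[ℝ] (F.image Prod.snd → ℝ) :=
    { toFun := fun d j => ∑ i, d (i, j)
      map_add' := fun d e => by ext; simp [sum_add_distrib]
      map_smul' := fun c d => by ext; simp [mul_sum] }
  have hker : LinearMap.ker ((R.prod C).comp ext) ≠ ⊥ := by
    apply LinearMap.ker_ne_bot_of_finrank_lt
    have := card_erase_add_one hmem
    simp only [Module.finrank_prod, Module.finrank_fintype_fun_eq_card, Fintype.card_coe]
    omega
  obtain ⟨f, hf, hf0⟩ := Submodule.exists_mem_ne_zero_of_ne_bot hker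
  have hext : ∀ p : F, ext f p = f p := fun p => Subtype.val_injective.extend_apply f 0 p
  have hsupp : ∀ p ∉ F, ext f p = 0 := fun p hp =>
    Function.extend_apply' _ _ _ fun ⟨a, ha⟩ => hp (ha ▸ a.2)
  obtain ⟨hR, hC⟩ := Prod.ext_iff.1 (LinearMap.mem_ker.1 hf)
  have hcols : ∀ j, ∑ i, ext f (i, j) = 0 := fun j => by
    by_cases hj : j ∈ F.image Prod.snd
    · exact congrFun hC ⟨j, hj⟩
    · exact sum_eq_zero fun i _ => hsupp _ fun h => hj (mem_image_of_mem Prod.snd h)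
  have hrows : ∀ i ≠ p₀.1, ∑ j, ext f (i, j) = 0 := fun i hi => by
    by_cases hi' : i ∈ F.image Prod.fst
    · exact congrFun hR ⟨i, mem_erase.2 ⟨hi, hi'⟩⟩
    · exact sum_eq_zero fun j _ => hsupp _ fun h => hi' (mem_image_of_mem Prod.fst h)
  refine ⟨ext f, fun h => hf0 ?_, hsupp, fun i => ?_, hcols⟩
  · ext p
    rw [← hext p, h]
    rfl
  · by_cases hi : i = p₀.1
    · have htotal : ∑ i, ∑ j, ext f (i, j) = 0 := by
        rw [sum_comm]
        exact sum_eq_zero fun j _ => hcols j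
      rwa [Fintype.sum_eq_single p₀.1 hrows, ← hi] at htotal
    · exact hrows i hi

/-- If numbers in `[0, 1]` have an integer sum and one of them is not an integer, then so is
another one. -/
theorem exists_ne_fractional_of_sum_eq_intCast {ι : Type*} [Fintype ι] [DecidableEq ι]
    (x : ι → ℝ) (z : ℤ) (hsum : ∑ i, x i = z) (hx : ∀ i, 0 ≤ x i ∧ x i ≤ 1) (i : ι)
    (hi : ¬(x i = 0 ∨ x i = 1)) : ∃ j, j ≠ i ∧ ¬(x j = 0 ∨ x j = 1) := by
  by_contra! h
  have hint : ∀ j ∈ Finset.univ.erase i, x j = ((⌊x j⌋ : ℤ) : ℝ) := fun j hj => by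
    rcases h j (Finset.ne_of_mem_erase hj) with h | h <;> simp [h]
  rw [← Finset.add_sum_erase _ _ (Finset.mem_univ i), Finset.sum_congr rfl hint,
    ← Int.cast_sum] at hsum
  have hxi : x i = ((z - ∑ j ∈ Finset.univ.erase i, ⌊x j⌋ : ℤ) : ℝ) := by
    rw [Int.cast_sub]
    linarith
  obtain ⟨h0, h1⟩ := hx i
  rw [hxi] at h0 h1 hi
  norm_cast at h0 h1 hi
  omega

/-- Points of `[0, 1]^ι` can be moved a little, in both directions, along any vector vanishing
on their coordinates equal to `0` or `1`. -/
theorem exists_pos_add_smul_mem_unitCube {ι : Type*} [Finite ι] (x d : ι → ℝ)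
    (hx : ∀ i, 0 ≤ x i ∧ x i ≤ 1) (hd : ∀ i, x i = 0 ∨ x i = 1 → d i = 0) :
    ∃ ε : ℝ, 0 < ε ∧ ∀ i, (0 ≤ x i + ε * d i ∧ x i + ε * d i ≤ 1) ∧
      (0 ≤ x i - ε * d i ∧ x i - ε * d i ≤ 1) := by
  have key : ∀ᶠ ε in nhdsWithin (0 : ℝ) (Set.Ioi 0), ∀ i,
      (0 ≤ x i + ε * d i ∧ x i + ε * d i ≤ 1) ∧
        (0 ≤ x i - ε * d i ∧ x i - ε * d i ≤ 1) := by
    refine Filter.eventually_all.2 fun i => ?_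
    by_cases hi : x i = 0 ∨ x i = 1
    · simp [hd i hi, hx i]
    · push Not at hi
      have hmem : x i ∈ Set.Ioo (0 : ℝ) 1 :=
        ⟨lt_of_le_of_ne (hx i).1 hi.1.symm, lt_of_le_of_ne (hx i).2 hi.2⟩
      have hadd : Filter.Tendsto (fun ε : ℝ => x i + ε * d i) (nhds 0) (nhds (x i)) :=
        Continuous.tendsto' (by fun_prop) _ _ (by simp)
      have hsub : Filter.Tendsto (fun ε : ℝ => x i - ε * d i) (nhds 0) (nhds (x i)) :=
        Continuous.tendsto' (by fun_prop) _ _ (by simp)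
      have hnhds := isOpen_Ioo.mem_nhds hmem
      filter_upwards [nhdsWithin_le_nhds (hadd hnhds), nhdsWithin_le_nhds (hsub hnhds)]
        with ε h₁ h₂
      exact ⟨⟨h₁.1.le, h₁.2.le⟩, h₂.1.le, h₂.2.le⟩
  obtain ⟨ε, hε, hpos⟩ := (key.and self_mem_nhdsWithin).exists
  exact ⟨ε, hpos, hε⟩

/-- The polytope of `[0, 1]`-valued matrices with row sums `r` and column sums `c`. -/
def boundedTransportationPolytope {I J : Type*} [Fintype I] [Fintype J] (r : I → ℤ) (c : J → ℤ) :
    Set (I × J → ℝ) :=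
  {x | (∀ i, ∑ j, x (i, j) = r i) ∧ (∀ j, ∑ i, x (i, j) = c j) ∧ ∀ p, 0 ≤ x p ∧ x p ≤ 1}

namespace boundedTransportationPolytope

variable {I J : Type*} [Fintype I] [Fintype J] (r : I → ℤ) (c : J → ℤ)

theorem isCompact : IsCompact (boundedTransportationPolytope r c) := by
  refine (isCompact_Icc (a := (0 : I × J → ℝ)) (b := 1)).of_isClosed_subset ?_
    fun x hx => ⟨fun p => (hx.2.2 p).1, fun p => (hx.2.2 p).2⟩
  simp only [boundedTransportationPolytope, Set.ofPred_and, Set.ofPred_forall]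
  refine .inter (isClosed_iInter fun i => ?_) (.inter (isClosed_iInter fun j => ?_)
    (isClosed_iInter fun p => .inter ?_ ?_))
  · exact isClosed_eq (by fun_prop) continuous_const
  · exact isClosed_eq (by fun_prop) continuous_const
  · exact isClosed_le continuous_const (by fun_prop)
  · exact isClosed_le (by fun_prop) continuous_const

variable {r c}

theorem eq_zero_or_one_of_mem_extremePoints {x : I × J → ℝ}
    (hx : x ∈ (boundedTransportationPolytope r c).extremePoints ℝ) (p : I × J) :
    x p = 0 ∨ x p = 1 := by
  classical
  by_contra hp
  obtain ⟨⟨hr, hc, hbox⟩, hext⟩ := hx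
  obtain ⟨d, hd0, hsupp, hdr, hdc⟩ := exists_ne_zero_support_subset_sum_eq_zero
    (Finset.univ.filter fun p => ¬(x p = 0 ∨ x p = 1)) ⟨p, by simpa using hp⟩
    (fun q hq => by
      simpa using exists_ne_fractional_of_sum_eq_intCast (fun j => x (q.1, j)) _ (hr q.1)
        (fun j => hbox _) q.2 (by simpa using hq))
    (fun q hq => by
      simpa using exists_ne_fractional_of_sum_eq_intCast (fun i => x (i, q.2)) _ (hc q.2)
        (fun i => hbox _) q.1 (by simpa using hq))
  obtain ⟨ε, hε, hcube⟩ := exists_pos_add_smul_mem_unitCube x d hbox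
    fun q hq => hsupp q fun h => (Finset.mem_filter.1 h).2 hq
  have hadd : x + ε • d ∈ boundedTransportationPolytope r c :=
    ⟨fun i => by simp [Finset.sum_add_distrib, ← Finset.mul_sum, hr, hdr],
      fun j => by simp [Finset.sum_add_distrib, ← Finset.mul_sum, hc, hdc],
      fun q => (hcube q).1⟩
  have hsub : x - ε • d ∈ boundedTransportationPolytope r c :=
    ⟨fun i => by simp [Finset.sum_sub_distrib, ← Finset.mul_sum, hr, hdr],
      fun j => by simp [Finset.sum_sub_distrib, ← Finset.mul_sum, hc, hdc],
      fun q => (hcube q).2⟩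
  have heq : x + ε • d = x := hext hadd hsub
    ⟨1 / 2, 1 / 2, by norm_num, by norm_num, by norm_num, by module⟩
  exact hd0 ((smul_eq_zero.1 (add_eq_left.1 heq)).resolve_left hε.ne')

end boundedTransportationPolytope

/-- A continuous linear functional on a nonempty compact set attains its minimum at an extreme
point. -/
theorem IsCompact.exists_extremePoint_isMinOn {E : Type*} [AddCommGroup E] [Module ℝ E]
    [TopologicalSpace E] [T2Space E] [IsTopologicalAddGroup E] [ContinuousSMul ℝ E]
    [LocallyConvexSpace ℝ E] {s : Set E} (hs : IsCompact s) (hne : s.Nonempty)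
    (l : StrongDual ℝ E) : ∃ x ∈ s.extremePoints ℝ, IsMinOn l s x := by
  have hexp : IsExposed ℝ s ((-l).toExposed s) := ContinuousLinearMap.toExposed.isExposed
  obtain ⟨y, hy, hmin⟩ := hs.exists_isMinOn hne l.continuous.continuousOn
  obtain ⟨x, hx⟩ := (hexp.isCompact hs).extremePoints_nonempty
    ⟨y, hy, fun z hz => neg_le_neg (hmin hz)⟩
  exact ⟨x, hexp.isExtreme.extremePoints_subset_extremePoints hx,
    fun z hz => neg_le_neg_iff.1 (hx.1.2 z hz)⟩


/-- Proposition 1 of the paper: the LP relaxation of the resource-allocation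
integer program attains its minimum at an integral (0/1) point, because the
constraint matrix is unimodular and the right-hand side is integral. -/
theorem lp_relaxation_integral_optimum
    (K N G : ℕ) (hK : 0 < K) (hN : 0 < N) (hG : 0 < G)
    (A : Matrix ((Fin N × Fin G) ⊕ Fin K) (Fin K × Fin N × Fin G) ℤ)
    (hA : ∀ (ns : Fin N × Fin G) (col : Fin K × Fin N × Fin G),
      A (Sum.inl ns) col = if col.2.1 = ns.1 ∧ col.2.2 = ns.2 then 1 else 0)
    (hA' : ∀ (k : Fin K) (col : Fin K × Fin N × Fin G),
      A (Sum.inr k) col = if col.1 = k then 1 else 0)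
    (b : (Fin N × Fin G) ⊕ Fin K → ℤ)
    (α : Fin K × Fin N × Fin G → ℝ)
    (P : Set (Fin K × Fin N × Fin G → ℝ))
    (hP : P = {x | (∀ row, ∑ col, (A row col : ℝ) * x col = (b row : ℝ)) ∧
      ∀ col, 0 ≤ x col ∧ x col ≤ 1})
    (hne : P.Nonempty) :
    ∃ xstar ∈ P, (∀ col, xstar col = 0 ∨ xstar col = 1) ∧
      ∀ x ∈ P, ∑ col, α col * xstar col ≤ ∑ col, α col * x col := by
  have hPeq : P = boundedTransportationPolytope (fun k => b (.inr k)) (fun ns => b (.inl ns)) := by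
    subst hP
    ext x
    have hrow (k : Fin K) : (∑ col : Fin K × Fin N × Fin G, if col.1 = k then x col else 0) =
        ∑ ns, x (k, ns) := by
      rw [Fintype.sum_prod_type, Fintype.sum_eq_single k fun k' hk' => by simp [hk']]
      simp
    have hcol (ns : Fin N × Fin G) :
        (∑ col : Fin K × Fin N × Fin G, if col.2 = ns then x col else 0) = ∑ k, x (k, ns) := by
      simp [Fintype.sum_prod_type_right' (f := fun k m => if m = ns then x (k, m) else 0)]
    simp only [boundedTransportationPolytope, Set.mem_ofPred_eq, Sum.forall, hA, hA',
      ← Prod.ext_iff, Int.cast_ite, Int.cast_one, Int.cast_zero, ite_mul, one_mul, zero_mul,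
      hrow, hcol]
    tauto
  subst hPeq
  obtain ⟨x, hx, hmin⟩ := (boundedTransportationPolytope.isCompact _ _).exists_extremePoint_isMinOn
    hne (∑ col, α col • ContinuousLinearMap.proj (R := ℝ) col)
  refine ⟨x, hx.1, boundedTransportationPolytope.eq_zero_or_one_of_mem_extremePoints hx,
    fun y hy => ?_⟩
  simpa using hmin hy
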